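/- Let f, g : Ω → 𝕂 with ∫ ρ|f|² dμ < ∞ and ∫ ρ|g|² dμ < ∞, and let Γ, γ ∈ 𝕂 with Re(Γ·conj(γ)) > 0. If ∫ ρ(t) Re[(Γ g(t) − f(t))(conj(f(t)) − conj(γ)·conj(g(t)))] dμ(t) ≥ 0, then (∫ ρ|f|² dμ)(∫ ρ|g|² dμ) − |∫ ρ f·conj(g) dμ|² ≤ (|Γ + γ| − 2√(Re(Γ·conj(γ)))) · |∫ ρ f·conj(g) dμ| · ∫ ρ|g|² dμ. -/

import Mathlib

open MeasureTheory

/-- Pointwise expansion of the integrand in the Schwarz reverse condition. -/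
lemma re_mul_conj_sub_expand {𝕜 : Type*} [RCLike 𝕜] (r : ℝ) (a b Γ γ : 𝕜) :
    r * RCLike.re ((Γ * b - a) *
        (starRingEnd 𝕜 a - starRingEnd 𝕜 γ * starRingEnd 𝕜 b)) =
      RCLike.re (starRingEnd 𝕜 (Γ + γ) * ((r : 𝕜) * (a * starRingEnd 𝕜 b))) -
        RCLike.re (Γ * starRingEnd 𝕜 γ) * (r * ‖b‖ ^ 2) - r * ‖a‖ ^ 2 := by
  simp only [← RCLike.normSq_eq_def', RCLike.normSq_apply, RCLike.mul_re, RCLike.mul_im,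
    RCLike.conj_re, RCLike.conj_im, map_add, map_sub, RCLike.ofReal_re, RCLike.ofReal_im]
  ring

/-- Weighted square integrability of two functions gives integrability of their product. -/
lemma integrable_weight_mul_conj {𝕜 Ω : Type*} [RCLike 𝕜] [MeasurableSpace Ω] {μ : Measure Ω}
    {ρ : Ω → ℝ} (hρ : Measurable ρ) (hρ0 : ∀ t, 0 ≤ ρ t) {f g : Ω → 𝕜}
    (hf : AEStronglyMeasurable f μ) (hg : AEStronglyMeasurable g μ)
    (hf2 : Integrable (fun t => ρ t * ‖f t‖ ^ 2) μ)
    (hg2 : Integrable (fun t => ρ t * ‖g t‖ ^ 2) μ) :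
    Integrable (fun t => (ρ t : 𝕜) * (f t * starRingEnd 𝕜 (g t))) μ := by
  refine (hf2.add hg2).mono' ?_ (.of_forall fun t => ?_)
  · exact (RCLike.continuous_ofReal.comp_aestronglyMeasurable hρ.aestronglyMeasurable).mul
      (hf.mul (RCLike.continuous_conj.comp_aestronglyMeasurable hg))
  · simp only [norm_mul, RCLike.norm_ofReal, RCLike.norm_conj, abs_of_nonneg (hρ0 t),
      Pi.add_apply, ← mul_add]
    exact mul_le_mul_of_nonneg_left
      (by nlinarith [sq_nonneg (‖f t‖ - ‖g t‖), sq_nonneg (‖f t‖ + ‖g t‖)]) (hρ0 t)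

theorem schwarz_reverse_dragomir_17
    {𝕜 Ω : Type*} [RCLike 𝕜] [MeasurableSpace Ω] (μ : Measure Ω)
    (ρ : Ω → ℝ) (hρ : Measurable ρ) (hρ0 : ∀ t, 0 ≤ ρ t)
    (f g : Ω → 𝕜)
    (hf : AEStronglyMeasurable f μ) (hg : AEStronglyMeasurable g μ)
    (hf2 : Integrable (fun t => ρ t * ‖f t‖ ^ 2) μ)
    (hg2 : Integrable (fun t => ρ t * ‖g t‖ ^ 2) μ)
    (Γ γ : 𝕜) (hΓγ : 0 < RCLike.re (Γ * starRingEnd 𝕜 γ))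
    (h : 0 ≤ ∫ t, ρ t *
        RCLike.re ((Γ * g t - f t) *
          (starRingEnd 𝕜 (f t) - starRingEnd 𝕜 γ * starRingEnd 𝕜 (g t))) ∂μ) :
    (∫ t, ρ t * ‖f t‖ ^ 2 ∂μ) * (∫ t, ρ t * ‖g t‖ ^ 2 ∂μ) -
        ‖∫ t, (ρ t : 𝕜) * (f t * starRingEnd 𝕜 (g t)) ∂μ‖ ^ 2 ≤
      (‖Γ + γ‖ - 2 * Real.sqrt (RCLike.re (Γ * starRingEnd 𝕜 γ))) *
          ‖∫ t, (ρ t : 𝕜) * (f t * starRingEnd 𝕜 (g t)) ∂μ‖ *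
        ∫ t, ρ t * ‖g t‖ ^ 2 ∂μ := by
  have hfg := integrable_weight_mul_conj hρ hρ0 hf hg hf2 hg2
  have hB : 0 ≤ ∫ t, ρ t * ‖g t‖ ^ 2 ∂μ :=
    integral_nonneg fun t => mul_nonneg (hρ0 t) (sq_nonneg _)
  have hcfg := hfg.const_mul (starRingEnd 𝕜 (Γ + γ))
  have hcg := hg2.const_mul (RCLike.re (Γ * starRingEnd 𝕜 γ))
  have hdiff : Integrable (fun t =>
      RCLike.re (starRingEnd 𝕜 (Γ + γ) * ((ρ t : 𝕜) * (f t * starRingEnd 𝕜 (g t)))) -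
        RCLike.re (Γ * starRingEnd 𝕜 γ) * (ρ t * ‖g t‖ ^ 2)) μ := hcfg.re.sub hcg
  simp only [re_mul_conj_sub_expand] at h
  rw [integral_sub hdiff hf2,
    integral_sub hcfg.re hcg, integral_re hcfg,
    integral_const_mul, integral_const_mul] at h
  set A := ∫ t, ρ t * ‖f t‖ ^ 2 ∂μ
  set B := ∫ t, ρ t * ‖g t‖ ^ 2 ∂μ
  set z := ∫ t, (ρ t : 𝕜) * (f t * starRingEnd 𝕜 (g t)) ∂μ
  have hre := RCLike.re_le_norm (starRingEnd 𝕜 (Γ + γ) * z)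
  rw [norm_mul, RCLike.norm_conj] at hre
  have hA : A ≤ ‖Γ + γ‖ * ‖z‖ - RCLike.re (Γ * starRingEnd 𝕜 γ) * B := by linarith
  have hAB := mul_le_mul_of_nonneg_right hA hB
  have hs := Real.sq_sqrt hΓγ.le
  set c := RCLike.re (Γ * starRingEnd 𝕜 γ)
  have hsB : (√c * B) ^ 2 = c * B ^ 2 := by rw [mul_pow, hs]
  linarith [sq_nonneg (√c * B - ‖z‖)]
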